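/- arXiv:1808.10092 — 6 statements merged into one kernel-verified Lean document; each statement's English description precedes it below -/
import Mathlib

section
/- For every integer k ≥ 1, the (1,2) entry of the product A_0 A_1 ⋯ A_{k−1} equals the (1,2) entry of the product B_0 B_1 ⋯ B_{k−1}; that is, e_1 A_0 A_1 ⋯ A_{k−1} e_2^T = e_1 B_0 B_1 ⋯ B_{k−1} e_2^T, where e_i denotes the i-th standard basis row vector. -/
/-- If `A i * C = C * B i` for all `i`, then `C` also intertwines the ordered products. -/
theorem Matrix.list_prod_map_mul_of_intertwine {ι m n R : Type*} [Fintype m] [Fintype n]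
    [DecidableEq m] [DecidableEq n] [Semiring R] {A : ι → Matrix m m R} {B : ι → Matrix n n R}
    {C : Matrix m n R} (h : ∀ i, A i * C = C * B i) (l : List ι) :
    (l.map A).prod * C = C * (l.map B).prod := by
  induction l with
  | nil => simp
  | cons i l ih =>
    rw [List.map_cons, List.map_cons, List.prod_cons, List.prod_cons, Matrix.mul_assoc, ih,
      ← Matrix.mul_assoc, h, Matrix.mul_assoc]

/-- For every integer `k ≥ 1`, the (1,2) entry of `A 0 * A 1 * ⋯ * A (k-1)`
equals the (1,2) entry of `B 0 * B 1 * ⋯ * B (k-1)`. -/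
theorem stmt0 (a b : ℕ → ℝ)
    (A : ℕ → Matrix (Fin 3) (Fin 3) ℝ)
    (B : ℕ → Matrix (Fin 2) (Fin 2) ℝ)
    (hA : ∀ k, A k = !![a k, b k, 0; a k, b k, 1; a k, b k, 0])
    (hB : ∀ k, B k = !![a k + b k, b k; 1, 0])
    (k : ℕ) (hk : 1 ≤ k) :
    (((List.range k).map A).prod) 0 1 = (((List.range k).map B).prod) 0 1 := by
  have h : ∀ i, A i * !![(1 : ℝ), 0; 1, 1; 1, 0] = !![(1 : ℝ), 0; 1, 1; 1, 0] * B i := by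
    intro i
    rw [hA, hB]
    ext r c
    fin_cases r <;> fin_cases c <;> simp [Matrix.mul_apply, Fin.sum_univ_succ, add_assoc]
  have key := congrFun₂ (Matrix.list_prod_map_mul_of_intertwine h (List.range k)) 0 1
  simpa [Matrix.mul_apply, Fin.sum_univ_succ] using key
end

section
/- Suppose a_k > 0 and b_k > 0 for all k, so that for n ≥ 2 all entries of A_0 A_1 ⋯ A_{n−1} and of B_0 B_1 ⋯ B_{n−1} are positive. If there is a real number γ_A such that for all i, j ∈ {1,2,3}, (1/n)·log(e_i A_0 A_1 ⋯ A_{n−1} e_j^T) → γ_A as n → ∞, and a real number γ_B such that for all i, j ∈ {1,2}, (1/n)·log(e_i B_0 B_1 ⋯ B_{n−1} e_j^T) → γ_B as n → ∞, then γ_A = γ_B. -/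
open Filter

/-- An intertwining relation between two sequences of matrices passes to their products. -/
theorem list_prod_map_mul_eq_mul_list_prod_map {ι m n R : Type*} [Fintype m] [DecidableEq m]
    [Fintype n] [DecidableEq n] [Semiring R] (A : ι → Matrix m m R) (B : ι → Matrix n n R)
    (U : Matrix m n R) (h : ∀ k, A k * U = U * B k) (l : List ι) :
    (l.map A).prod * U = U * (l.map B).prod := by
  induction l with
  | nil => simp
  | cons k l ih =>
    rw [List.map_cons, List.prod_cons, List.map_cons, List.prod_cons, Matrix.mul_assoc, ih,
      ← Matrix.mul_assoc, h, Matrix.mul_assoc]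

/-- If all `a k, b k > 0` and the normalized logarithms of the entries of the
matrix products `A 0 ⋯ A (n-1)` (resp. `B 0 ⋯ B (n-1)`) converge to `γA` (resp. `γB`)
for all choices of entries, then `γA = γB`. -/
theorem stmt1 (a b : ℕ → ℝ) (ha : ∀ k, 0 < a k) (hb : ∀ k, 0 < b k)
    (A : ℕ → Matrix (Fin 3) (Fin 3) ℝ)
    (B : ℕ → Matrix (Fin 2) (Fin 2) ℝ)
    (hA : ∀ k, A k = !![a k, b k, 0; a k, b k, 1; a k, b k, 0])
    (hB : ∀ k, B k = !![a k + b k, b k; 1, 0])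
    (γA γB : ℝ)
    (hγA : ∀ i j : Fin 3,
      Tendsto (fun n : ℕ => Real.log ((((List.range n).map A).prod) i j) / n)
        atTop (nhds γA))
    (hγB : ∀ i j : Fin 2,
      Tendsto (fun n : ℕ => Real.log ((((List.range n).map B).prod) i j) / n)
        atTop (nhds γB)) :
    γA = γB := by
  have key : ∀ n : ℕ, (((List.range n).map A).prod) 0 1 = (((List.range n).map B).prod) 0 1 := by
    intro n
    have h := list_prod_map_mul_eq_mul_list_prod_map A B !![1, 0; 1, 1; 1, 0]
      (fun k => by
        rw [hA, hB]
        ext i j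
        fin_cases i <;> fin_cases j <;> simp [Matrix.mul_apply, Fin.sum_univ_succ, add_assoc])
      (List.range n)
    simpa [Matrix.mul_apply, Fin.sum_univ_succ] using congrFun (congrFun h 0) 1
  refine tendsto_nhds_unique (hγA 0 1) ?_
  simpa only [key] using hγB 0 1
end

section
/- If the path x_0, …, x_t first hits n at time t, then for every integer y with 0 ≤ y ≤ n − 1 one has R(y) = L_1(y+1) + L_2(y+1) + L_2(y+2) + 1. -/
/-- For a path started at `0` with steps in `{1, -1, -2}` and a level `y ≥ 0`, the up-crossings of
the edge `(y, y + 1)` before time `k` exceed its down-crossings by one exactly when `x k > y`. -/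
theorem card_upcrossings_eq (x : ℕ → ℤ) (hx0 : x 0 = 0) (y : ℤ) (hy : 0 ≤ y) (k : ℕ)
    (hstep : ∀ s < k, x (s + 1) - x s = 1 ∨ x (s + 1) - x s = -1 ∨ x (s + 1) - x s = -2) :
    ((Finset.range k).filter (fun s => x s = y ∧ x (s + 1) = y + 1)).card =
      ((Finset.range k).filter (fun s => x s = y + 1 ∧ x (s + 1) = y + 1 - 1)).card +
      ((Finset.range k).filter (fun s => x s = y + 1 ∧ x (s + 1) = y + 1 - 2)).card +
      ((Finset.range k).filter (fun s => x s = y + 2 ∧ x (s + 1) = y + 2 - 2)).card +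
      if y < x k then 1 else 0 := by
  induction k with
  | zero => simp [hx0, hy]
  | succ k ih =>
    have ih := ih fun s hs => hstep s (by omega)
    have hk := hstep k (by omega)
    simp only [Finset.card_filter, Finset.sum_range_succ] at ih ⊢
    split_ifs at ih ⊢ <;> omega


/-- If the path `x 0, …, x t` first hits `n` at time `t`, then for every
integer `y` with `0 ≤ y ≤ n - 1`, `R y = L1 (y+1) + L2 (y+1) + L2 (y+2) + 1`. -/
theorem stmt2 (n t : ℕ) (hn : 1 ≤ n) (ht : 1 ≤ t) (x : ℕ → ℤ)
    (hx0 : x 0 = 0)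
    (hstep : ∀ s < t, x (s + 1) - x s = 1 ∨ x (s + 1) - x s = -1 ∨ x (s + 1) - x s = -2)
    (hhit : x t = n) (hbefore : ∀ s < t, x s < n)
    (R L1 L2 : ℤ → ℕ)
    (hR : ∀ y, R y = ((Finset.range t).filter (fun s => x s = y ∧ x (s + 1) = y + 1)).card)
    (hL1 : ∀ y, L1 y = ((Finset.range t).filter (fun s => x s = y ∧ x (s + 1) = y - 1)).card)
    (hL2 : ∀ y, L2 y = ((Finset.range t).filter (fun s => x s = y ∧ x (s + 1) = y - 2)).card) :
    ∀ y : ℤ, 0 ≤ y → y ≤ (n : ℤ) - 1 →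
      R y = L1 (y + 1) + L2 (y + 1) + L2 (y + 2) + 1 := by
  intro y hy hyn
  have h := card_upcrossings_eq x hx0 y hy t hstep
  rw [if_pos (by omega)] at h
  rw [hR, hL1, hL2, hL2, h]
end

section
/- Let p, q ≥ 0 with p + q < 1. Then the family indexed by (a,b) ∈ ℕ² with terms a · ((a+b)!/(a!·b!)) · p^a · q^b · (1 − p − q) is summable with sum p/(1 − p − q), and the family with terms b · ((a+b)!/(a!·b!)) · p^a · q^b · (1 − p − q) is summable with sum q/(1 − p − q). (Hence, with p = ω(−1), q = ω(−2), 1 − p − q = ω(1), the mean offspring vector of the linear fractional distribution is (ω(−1)/ω(1), ω(−2)/ω(1)).) -/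
theorem HasSum.of_prod_fiberwise_of_nonneg {α β : Type*} {f : α × β → ℝ} {g : α → ℝ} {s : ℝ}
    (hf : 0 ≤ f) (hfg : ∀ a, HasSum (fun b => f (a, b)) (g a)) (hg : HasSum g s) :
    HasSum f s := by
  have hsum : Summable f := (summable_prod_of_nonneg hf).2
    ⟨fun a => (hfg a).summable, by simpa only [(hfg _).tsum_eq] using hg.summable⟩
  have hs := (hsum.hasSum.prod_fiberwise hfg).unique hg
  exact hs ▸ hsum.hasSum

theorem hasSum_fst_mul_linearFractional (p q : ℝ) (hp : 0 ≤ p) (hq : 0 ≤ q) (hpq : p + q < 1) :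
    HasSum (fun ab : ℕ × ℕ =>
        (ab.1 : ℝ) * (((Nat.factorial (ab.1 + ab.2) : ℝ) /
            ((Nat.factorial ab.1 : ℝ) * (Nat.factorial ab.2 : ℝ)))
          * p ^ ab.1 * q ^ ab.2 * (1 - p - q)))
      (p / (1 - p - q)) := by
  have hq1 : 0 < 1 - q := by linarith
  have hr : 0 < 1 - p - q := by linarith
  refine HasSum.of_prod_fiberwise_of_nonneg
    (g := fun a : ℕ => (1 - p - q) / (1 - q) * ((a : ℝ) * (p / (1 - q)) ^ a)) ?_ ?_ ?_
  · intro ab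
    dsimp only [Pi.zero_apply]
    positivity
  · intro a
    have h := (hasSum_choose_mul_geometric_of_norm_lt_one a (r := q)
      (by rw [Real.norm_of_nonneg hq]; linarith)).mul_left ((a : ℝ) * p ^ a * (1 - p - q))
    convert! h using 1
    · funext b
      rw [Nat.cast_choose ℝ (Nat.le_add_left a b), Nat.add_sub_cancel, Nat.add_comm b a]
      ring
    · rw [div_pow, pow_succ]
      field_simp
  · have h := (hasSum_coe_mul_geometric_of_norm_lt_one (r := p / (1 - q))
      (by rw [Real.norm_of_nonneg (by positivity), div_lt_one hq1]; linarith)).mul_left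
        ((1 - p - q) / (1 - q))
    convert! h using 1
    have h1 : 1 - p / (1 - q) = (1 - p - q) / (1 - q) := by
      field_simp
      ring
    rw [h1]
    field_simp

/-- marginal means of the linear fractional offspring distribution:
for `p, q ≥ 0` with `p + q < 1`, the family `a·((a+b)!/(a!·b!))·p^a·q^b·(1-p-q)` has
sum `p/(1-p-q)` and the family `b·((a+b)!/(a!·b!))·p^a·q^b·(1-p-q)` has sum `q/(1-p-q)`. -/
theorem stmt6 (p q : ℝ) (hp : 0 ≤ p) (hq : 0 ≤ q) (hpq : p + q < 1) :
    HasSum (fun ab : ℕ × ℕ =>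
        (ab.1 : ℝ) * (((Nat.factorial (ab.1 + ab.2) : ℝ) /
            ((Nat.factorial ab.1 : ℝ) * (Nat.factorial ab.2 : ℝ)))
          * p ^ ab.1 * q ^ ab.2 * (1 - p - q)))
      (p / (1 - p - q)) ∧
    HasSum (fun ab : ℕ × ℕ =>
        (ab.2 : ℝ) * (((Nat.factorial (ab.1 + ab.2) : ℝ) /
            ((Nat.factorial ab.1 : ℝ) * (Nat.factorial ab.2 : ℝ)))
          * p ^ ab.1 * q ^ ab.2 * (1 - p - q)))
      (q / (1 - p - q)) := by
  refine ⟨hasSum_fst_mul_linearFractional p q hp hq hpq, ?_⟩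
  have h := (Equiv.prodComm ℕ ℕ).hasSum_iff.2
    (hasSum_fst_mul_linearFractional q p hq hp (by linarith))
  convert! h using 1
  · funext ab
    simp only [Function.comp_apply, Equiv.prodComm_apply, Prod.fst_swap, Prod.snd_swap,
      Nat.add_comm ab.2 ab.1]
    ring
  · rw [sub_right_comm]
end

section
/- Let u, v ≥ 0 with u + v < 1, and let N ∈ ℕ. Then the family indexed by (a,b) ∈ ℕ² with terms ((a+b+N)!/(a!·b!·N!)) · u^a · v^b is summable, and its sum equals 1/(1 − u − v)^{N+1}. -/
open Finset in
/-- Summing the trinomial terms over an antidiagonal gives a negative binomial term. -/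
theorem sum_antidiagonal_factorial_div_mul_pow {K : Type*} [Field K] [CharZero K]
    (u v : K) (N n : ℕ) :
    ∑ ab ∈ antidiagonal n,
        ((Nat.factorial (ab.1 + ab.2 + N) : K) /
            ((Nat.factorial ab.1 : K) * (Nat.factorial ab.2 : K) * (Nat.factorial N : K)))
          * u ^ ab.1 * v ^ ab.2 = ((n + N).choose N : K) * (u + v) ^ n := by
  rw [(Commute.all u v).add_pow', mul_sum]
  refine sum_congr rfl fun ab hab => ?_
  obtain rfl := mem_antidiagonal.mp hab
  rw [nsmul_eq_mul, Nat.cast_add_choose, ← Nat.choose_symm_add, Nat.cast_add_choose]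
  have h : ∀ k : ℕ, (Nat.factorial k : K) ≠ 0 := fun k => Nat.cast_ne_zero.mpr k.factorial_ne_zero
  field_simp [h]

/-- A nonnegative family on `A × A` whose antidiagonal sums have sum `s` has sum `s`. -/
theorem hasSum_prod_of_hasSum_sum_antidiagonal {A : Type*} [AddCommMonoid A]
    [Finset.HasAntidiagonal A] {f : A × A → ℝ} (hf : ∀ x, 0 ≤ f x) {s : ℝ}
    (h : HasSum (fun n => ∑ x ∈ Finset.HasAntidiagonal.antidiagonal n, f x) s) : HasSum f s := by
  rw [← Finset.HasAntidiagonal.sigmaAntidiagonalEquivProd.hasSum_iff]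
  have hfib : ∀ n : A, HasSum (fun x : Finset.HasAntidiagonal.antidiagonal n => f x)
      (∑ x ∈ Finset.HasAntidiagonal.antidiagonal n, f x) := fun n => Finset.hasSum _ f
  have hsum : Summable (f ∘ Finset.HasAntidiagonal.sigmaAntidiagonalEquivProd) := by
    refine (summable_sigma_of_nonneg fun x => hf _).mpr ⟨fun n => (hfib n).summable, ?_⟩
    exact h.summable.congr fun n => (hfib n).tsum_eq.symm
  have hs := hsum.hasSum.sigma hfib
  exact hs.unique h ▸ hsum.hasSum

/-- bivariate negative binomial expansion: for `u, v ≥ 0` with `u + v < 1`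
and `N ∈ ℕ`, the family `((a+b+N)!/(a!·b!·N!))·u^a·v^b` has sum `1/(1-u-v)^(N+1)`. -/
theorem stmt7 (u v : ℝ) (hu : 0 ≤ u) (hv : 0 ≤ v) (huv : u + v < 1) (N : ℕ) :
    HasSum (fun ab : ℕ × ℕ =>
        ((Nat.factorial (ab.1 + ab.2 + N) : ℝ) /
            ((Nat.factorial ab.1 : ℝ) * (Nat.factorial ab.2 : ℝ) * (Nat.factorial N : ℝ)))
          * u ^ ab.1 * v ^ ab.2)
      (1 / (1 - u - v) ^ (N + 1)) := by
  have hr : ‖u + v‖ < 1 := by rwa [Real.norm_of_nonneg (add_nonneg hu hv)]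
  refine hasSum_prod_of_hasSum_sum_antidiagonal (fun x => by positivity) ?_
  simp_rw [sum_antidiagonal_factorial_div_mul_pow, sub_sub]
  exact hasSum_choose_mul_geometric_of_norm_lt_one N hr
end

section
/- For all s ∈ [0,1]³ and all n ≥ 1, the n-fold composition satisfies (f_1 ∘ f_2 ∘ ⋯ ∘ f_n)(s) = 1 − (A_1 A_2 ⋯ A_n (1 − s)) / (1 + Σ_{k=1}^{n} e_1 (A_k A_{k+1} ⋯ A_n)(1 − s)), where 1 = (1,1,1)^T, the quotient is the vector A_1⋯A_n(1−s) divided by the positive scalar in the denominator, and e_1 is the first standard basis row vector. More generally, for 1 ≤ k ≤ n, the first component of (f_k ∘ ⋯ ∘ f_n)(s) equals 1 − (e_1 (A_k ⋯ A_n)(1 − s)) / (1 + Σ_{j=k}^{n} e_1 (A_j ⋯ A_n)(1 − s)). -/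
open Matrix

/-- The linear fractional map `f_k(s) = 1 - A_k(1-s)/(1 + e₁ A_k (1-s))`. -/
noncomputable def fStep (A : ℕ → Matrix (Fin 3) (Fin 3) ℝ) (k : ℕ) (s : Fin 3 → ℝ) :
    Fin 3 → ℝ :=
  fun i => 1 - (A k *ᵥ fun j => 1 - s j) i / (1 + (A k *ᵥ fun j => 1 - s j) 0)

/-- The composition `f_k ∘ f_{k+1} ∘ ⋯ ∘ f_n` (the identity when `k > n`). -/
noncomputable def fComp (A : ℕ → Matrix (Fin 3) (Fin 3) ℝ) (k n : ℕ) (s : Fin 3 → ℝ) :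
    Fin 3 → ℝ :=
  (List.range' k (n + 1 - k)).foldr (fun j v => fStep A j v) s

/-- The ordered matrix product `A_k A_{k+1} ⋯ A_n` (the identity when `k > n`). -/
noncomputable def prodMat (A : ℕ → Matrix (Fin 3) (Fin 3) ℝ) (k n : ℕ) :
    Matrix (Fin 3) (Fin 3) ℝ :=
  ((List.range' k (n + 1 - k)).map A).prod

theorem fComp_eq_fStep (A : ℕ → Matrix (Fin 3) (Fin 3) ℝ) {k n : ℕ} (hk : k ≤ n)
    (s : Fin 3 → ℝ) : fComp A k n s = fStep A k (fComp A (k + 1) n s) := by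
  have h : n + 1 - k = (n + 1 - (k + 1)) + 1 := by omega
  rw [fComp, h, List.range'_succ, List.foldr_cons, fComp]

theorem prodMat_eq_mul (A : ℕ → Matrix (Fin 3) (Fin 3) ℝ) {k n : ℕ} (hk : k ≤ n) :
    prodMat A k n = A k * prodMat A (k + 1) n := by
  have h : n + 1 - k = (n + 1 - (k + 1)) + 1 := by omega
  rw [prodMat, h, List.range'_succ, List.map_cons, List.prod_cons, prodMat]

theorem prodMat_mulVec_nonneg (A : ℕ → Matrix (Fin 3) (Fin 3) ℝ) (hA : ∀ k i j, 0 ≤ A k i j)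
    {u : Fin 3 → ℝ} (hu : ∀ i, 0 ≤ u i) {k n : ℕ} (hk : k ≤ n + 1) (i : Fin 3) :
    0 ≤ (prodMat A k n *ᵥ u) i := by
  induction hk using Nat.decreasingInduction generalizing i with
  | self => simpa [prodMat] using hu i
  | of_succ k hk ih =>
    rw [prodMat_eq_mul A (Nat.lt_succ_iff.mp hk), ← mulVec_mulVec]
    exact dotProduct_nonneg_of_nonneg (fun j => hA k i j) ih

/-- Closed form of the composition `f_k ∘ ⋯ ∘ f_n`, including the empty one. -/
theorem fComp_eq (A : ℕ → Matrix (Fin 3) (Fin 3) ℝ) (hA : ∀ k i j, 0 ≤ A k i j)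
    (s : Fin 3 → ℝ) (hs : ∀ i, s i ≤ 1) {k n : ℕ} (hk : k ≤ n + 1) :
    fComp A k n s = fun i => 1 - (prodMat A k n *ᵥ fun j => 1 - s j) i
      / (1 + ∑ j ∈ Finset.Icc k n, (prodMat A j n *ᵥ fun j => 1 - s j) 0) := by
  induction hk using Nat.decreasingInduction with
  | self => simp [fComp, prodMat]
  | of_succ k hk ih =>
    have hkn : k ≤ n := Nat.lt_succ_iff.mp hk
    rw [fComp_eq_fStep A hkn, ih, ← Finset.add_sum_Ioc_eq_sum_Icc hkn,
      ← Finset.Icc_add_one_left_eq_Ioc]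
    have hnn : ∀ j ≤ n, 0 ≤ (prodMat A j n *ᵥ fun j => 1 - s j) 0 := fun j hj =>
      prodMat_mulVec_nonneg A hA (fun i => sub_nonneg.2 (hs i)) (by omega) 0
    have hD : 0 < 1 + ∑ j ∈ Finset.Icc (k + 1) n, (prodMat A j n *ᵥ fun j => 1 - s j) 0 :=
      add_pos_of_pos_of_nonneg one_pos
        (Finset.sum_nonneg fun j hj => hnn j (Finset.mem_Icc.1 hj).2)
    have hV := hnn k hkn
    generalize ∑ j ∈ Finset.Icc (k + 1) n, (prodMat A j n *ᵥ fun j => 1 - s j) 0 = D at hD ⊢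
    have key : (A k *ᵥ fun i => 1 - (1 - (prodMat A (k + 1) n *ᵥ fun j => 1 - s j) i / (1 + D)))
        = (1 + D)⁻¹ • (prodMat A k n *ᵥ fun j => 1 - s j) := by
      rw [prodMat_eq_mul A hkn, ← mulVec_mulVec, ← mulVec_smul]
      congr 1
      ext i
      simp [div_eq_inv_mul]
    funext i
    simp only [fStep, key, Pi.smul_apply, smul_eq_mul]
    have h₁ : 1 + (1 + D)⁻¹ * (prodMat A k n *ᵥ fun j => 1 - s j) 0 ≠ 0 := by positivity
    have h₂ : 1 + ((prodMat A k n *ᵥ fun j => 1 - s j) 0 + D) ≠ 0 := by linarith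
    congr 1
    rw [div_eq_div_iff h₁ h₂]
    field_simp
    ring

/-- for `s ∈ [0,1]³` and `n ≥ 1`,
`(f₁ ∘ ⋯ ∘ f_n)(s) = 1 - (A₁⋯A_n)(1-s) / (1 + ∑_{k=1}^n e₁(A_k⋯A_n)(1-s))`, and more
generally for `1 ≤ k ≤ n` the first component of `(f_k ∘ ⋯ ∘ f_n)(s)` equals
`1 - e₁(A_k⋯A_n)(1-s) / (1 + ∑_{j=k}^n e₁(A_j⋯A_n)(1-s))`. -/
theorem stmt9 (A : ℕ → Matrix (Fin 3) (Fin 3) ℝ) (hA : ∀ k i j, 0 ≤ A k i j)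
    (s : Fin 3 → ℝ) (hs : ∀ i, s i ∈ Set.Icc (0 : ℝ) 1) (n : ℕ) (hn : 1 ≤ n) :
    (fComp A 1 n s = fun i =>
      1 - (prodMat A 1 n *ᵥ fun j => 1 - s j) i
        / (1 + ∑ k ∈ Finset.Icc 1 n, (prodMat A k n *ᵥ fun j => 1 - s j) 0)) ∧
    ∀ k, 1 ≤ k → k ≤ n →
      fComp A k n s 0 =
        1 - (prodMat A k n *ᵥ fun i => 1 - s i) 0
          / (1 + ∑ j ∈ Finset.Icc k n, (prodMat A j n *ᵥ fun i => 1 - s i) 0) := by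
  have h {k : ℕ} (hk : k ≤ n + 1) := fComp_eq A hA s (fun i => (hs i).2) hk
  exact ⟨h (by omega), fun k _ hk => congrFun (h (by omega)) 0⟩
end
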